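/- arXiv:1912.00152 — 2 statements merged into one kernel-verified Lean document; each statement's English description precedes it below -/
import Mathlib

section
/- Let Ω be a nonempty bounded open subset of ℝ^N. If 1 < p < s < +∞, then p [λ_p(Ω)]^{1/p} ≤ s [λ_s(Ω)]^{1/s}. -/
open MeasureTheory

/-- The first eigenvalue of the Finsler `p`-Laplacian on `Ω`, defined by the Rayleigh quotient
over smooth compactly supported test functions in `Ω`. -/
noncomputable def finslerLambda (N : ℕ) (F : EuclideanSpace ℝ (Fin N) → ℝ) (p : ℝ)
    (Ω : Set (EuclideanSpace ℝ (Fin N))) : ℝ :=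
  sInf ((fun u : EuclideanSpace ℝ (Fin N) → ℝ =>
      (∫ x in Ω, F (gradient u x) ^ p) / (∫ x in Ω, |u x| ^ p)) ''
    {u | ContDiff ℝ (⊤ : ℕ∞) u ∧ HasCompactSupport u ∧ tsupport u ⊆ Ω ∧ u ≠ 0})

/-- The smooth function `t (t² + e)^{(q-1)/2}`, which regularizes `|t|^q` up to sign. -/
noncomputable def regPow (q e t : ℝ) : ℝ := t * (t ^ 2 + e) ^ ((q - 1) / 2)

lemma contDiff_regPow (q : ℝ) {e : ℝ} (he : 0 < e) : ContDiff ℝ (⊤ : ℕ∞) (regPow q e) := by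
  have h : ContDiff ℝ (⊤ : ℕ∞) fun t : ℝ => t ^ 2 + e := by fun_prop
  exact contDiff_id.mul (h.rpow_const_of_ne fun t => by positivity)

lemma rpow_abs_le_abs_regPow {q e : ℝ} (hq : 1 ≤ q) (he : 0 < e) (t : ℝ) :
    |t| ^ q ≤ |regPow q e t| := by
  rcases eq_or_ne t 0 with rfl | ht
  · rw [abs_zero, Real.zero_rpow (by linarith)]
    exact abs_nonneg _
  have ht' : 0 < |t| := abs_pos.2 ht
  have h1 : |t| ^ (q - 1) ≤ (t ^ 2 + e) ^ ((q - 1) / 2) := by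
    calc |t| ^ (q - 1) = (|t| ^ (2 : ℝ)) ^ ((q - 1) / 2) := by
          rw [← Real.rpow_mul ht'.le]; congr 1; ring
      _ = (t ^ 2) ^ ((q - 1) / 2) := by rw [Real.rpow_two, sq_abs]
      _ ≤ _ := Real.rpow_le_rpow (by positivity) (by linarith) (by linarith)
  calc |t| ^ q = |t| * |t| ^ (q - 1) := by
        rw [← Real.rpow_one_add' ht'.le (by linarith)]; congr 1; ring
    _ ≤ |t| * (t ^ 2 + e) ^ ((q - 1) / 2) := by gcongr
    _ = |regPow q e t| := by
        rw [regPow, abs_mul, abs_of_nonneg (a := (t ^ 2 + e) ^ ((q - 1) / 2)) (by positivity)]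

lemma abs_deriv_regPow_le {q e : ℝ} (hq : 1 ≤ q) (he : 0 < e) (t : ℝ) :
    |deriv (regPow q e) t| ≤ q * (t ^ 2 + e) ^ ((q - 1) / 2) := by
  have hpos : 0 < t ^ 2 + e := by positivity
  have h1 : HasDerivAt (fun t : ℝ => t ^ 2 + e) (2 * t) t := by
    simpa using (hasDerivAt_pow 2 t).add_const e
  have h2 : HasDerivAt (regPow q e) _ t :=
    (hasDerivAt_id t).mul (h1.rpow_const (p := (q - 1) / 2) (Or.inl hpos.ne'))
  have h3 : (t ^ 2 + e) ^ ((q - 1) / 2) = (t ^ 2 + e) ^ ((q - 1) / 2 - 1) * (t ^ 2 + e) := by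
    rw [← Real.rpow_add_one hpos.ne']; congr 1; ring
  have h4 : 0 ≤ (t ^ 2 + e) ^ ((q - 1) / 2 - 1) := by positivity
  have h5 : deriv (regPow q e) t = (t ^ 2 + e) ^ ((q - 1) / 2 - 1) * (q * t ^ 2 + e) := by
    rw [h2.deriv, h3, id]; ring
  rw [h5, abs_of_nonneg (by positivity), h3, mul_left_comm]
  refine mul_le_mul_of_nonneg_left ?_ h4
  nlinarith

lemma gradient_comp_real {E : Type*} [NormedAddCommGroup E] [InnerProductSpace ℝ E]
    [CompleteSpace E] {φ : ℝ → ℝ} {u : E → ℝ} {x : E} (hφ : DifferentiableAt ℝ φ (u x))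
    (hu : DifferentiableAt ℝ u x) :
    gradient (φ ∘ u) x = deriv φ (u x) • gradient u x := by
  rw [gradient, gradient, (hφ.hasDerivAt.comp_hasFDerivAt x hu.hasFDerivAt).fderiv, map_smulₛₗ]
  simp

lemma continuous_gradient {E : Type*} [NormedAddCommGroup E] [InnerProductSpace ℝ E]
    [CompleteSpace E] {u : E → ℝ} (hu : ContDiff ℝ (⊤ : ℕ∞) u) : Continuous (gradient u) :=
  (InnerProductSpace.toDual ℝ E).symm.continuous.comp (hu.continuous_fderiv (by simp))

lemma HasCompactSupport.exists_norm_gradient_le {E : Type*} [NormedAddCommGroup E]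
    [InnerProductSpace ℝ E] [CompleteSpace E] {u : E → ℝ} (hu : ContDiff ℝ (⊤ : ℕ∞) u)
    (hc : HasCompactSupport u) : ∃ C, ∀ x, ‖gradient u x‖ ≤ C := by
  obtain ⟨C, hC⟩ := (hc.fderiv ℝ).exists_bound_of_continuous (hu.continuous_fderiv (by simp))
  exact ⟨C, fun x => by simpa [gradient] using hC x⟩

/-- Hölder's inequality for `f ^ p * g ^ (s - p)` with bounded nonnegative `f`, `g`. -/
lemma integral_rpow_mul_rpow_le {α : Type*} [MeasurableSpace α] {μ : Measure α}
    [IsFiniteMeasure μ] {f g : α → ℝ} {p s C D : ℝ} (hp : 0 < p) (hps : p < s)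
    (hf : Measurable f) (hg : Measurable g) (hf0 : ∀ x, 0 ≤ f x) (hg0 : ∀ x, 0 ≤ g x)
    (hfC : ∀ x, f x ≤ C) (hgD : ∀ x, g x ≤ D) :
    ∫ x, f x ^ p * g x ^ (s - p) ∂μ ≤
      (∫ x, f x ^ s ∂μ) ^ (p / s) * (∫ x, g x ^ s ∂μ) ^ (1 - p / s) := by
  have hs : 0 < s := hp.trans hps
  have hsp : 0 < s - p := sub_pos.2 hps
  have hconj : (s / p).HolderConjugate (s / (s - p)) := by
    rw [Real.holderConjugate_iff]
    refine ⟨(one_lt_div hp).2 hps, ?_⟩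
    rw [inv_div, inv_div]; field_simp; ring
  have key := integral_mul_le_Lp_mul_Lq_of_nonneg (μ := μ) hconj
    (f := fun x => f x ^ p) (g := fun x => g x ^ (s - p))
    (.of_forall fun x => Real.rpow_nonneg (hf0 x) _)
    (.of_forall fun x => Real.rpow_nonneg (hg0 x) _)
    (MemLp.of_bound (hf.pow_const p).aestronglyMeasurable (C ^ p) (.of_forall fun x => by
      rw [Real.norm_of_nonneg (Real.rpow_nonneg (hf0 x) _)]
      exact Real.rpow_le_rpow (hf0 x) (hfC x) hp.le))
    (MemLp.of_bound (hg.pow_const _).aestronglyMeasurable (D ^ (s - p)) (.of_forall fun x => by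
      rw [Real.norm_of_nonneg (Real.rpow_nonneg (hg0 x) _)]
      exact Real.rpow_le_rpow (hg0 x) (hgD x) hsp.le))
  have e1 : ∀ x, (f x ^ p) ^ (s / p) = f x ^ s := fun x => by
    rw [← Real.rpow_mul (hf0 x), mul_div_cancel₀ _ hp.ne']
  have e2 : ∀ x, (g x ^ (s - p)) ^ (s / (s - p)) = g x ^ s := fun x => by
    rw [← Real.rpow_mul (hg0 x), mul_div_cancel₀ _ hsp.ne']
  have e3 : 1 - p / s = (s - p) / s := by field_simp
  simpa only [e1, e2, one_div_div, e3] using key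

lemma tendsto_integral_sqrt_sq_add_rpow {α : Type*} [MeasurableSpace α] {μ : Measure α}
    [IsFiniteMeasure μ] {u : α → ℝ} {s C : ℝ} (hs : 0 < s) (hu : Measurable u)
    (huC : ∀ x, |u x| ≤ C) :
    Filter.Tendsto (fun e : ℝ => ∫ x, √(u x ^ 2 + e) ^ s ∂μ) (nhdsWithin 0 (Set.Ioi 0))
      (nhds (∫ x, |u x| ^ s ∂μ)) := by
  refine tendsto_integral_filter_of_dominated_convergence (fun _ => √(C ^ 2 + 1) ^ s)
    (.of_forall fun e => (((hu.pow_const 2).add_const e).sqrt.pow_const s).aestronglyMeasurable)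
    ?_ (integrable_const _) (.of_forall fun x => ?_)
  · filter_upwards [Ioo_mem_nhdsGT (zero_lt_one (α := ℝ))] with e he
    refine .of_forall fun x => ?_
    rw [Real.norm_of_nonneg (by positivity)]
    have := sq_le_sq' (neg_le_of_abs_le (huC x)) (le_of_abs_le (huC x))
    have h2 := he.2.le
    gcongr
  · have : Continuous fun e : ℝ => √(u x ^ 2 + e) ^ s :=
      (Real.continuous_sqrt.comp (by fun_prop)).rpow_const fun _ => Or.inr hs.le
    have h := (this.tendsto 0).mono_left (nhdsWithin_le_nhds (s := Set.Ioi 0))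
    simpa [Real.sqrt_sq_eq_abs] using h

lemma setIntegral_rpow_abs_pos {E : Type*} [NormedAddCommGroup E] [NormedSpace ℝ E]
    [MeasurableSpace E] [BorelSpace E] {μ : Measure E} [IsFiniteMeasureOnCompacts μ]
    [μ.IsOpenPosMeasure] {u : E → ℝ} {Ω : Set E} {s : ℝ} (hs : 0 < s)
    (hu : Continuous u) (hc : HasCompactSupport u) (hsub : tsupport u ⊆ Ω) (h0 : u ≠ 0) :
    0 < ∫ x in Ω, |u x| ^ s ∂μ := by
  have hz : ∀ x, u x = 0 → |u x| ^ s = 0 := fun x hx => by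
    rw [hx, abs_zero, Real.zero_rpow hs.ne']
  rw [setIntegral_eq_integral_of_forall_compl_eq_zero fun x hx =>
    hz x (image_eq_zero_of_notMem_tsupport fun h => hx (hsub h))]
  obtain ⟨x, hx⟩ := Function.ne_iff.1 h0
  refine Continuous.integral_pos_of_hasCompactSupport_nonneg_nonzero (x := x)
    (hu.abs.rpow_const fun _ => Or.inr hs.le) ?_ (fun x => by positivity) ?_
  · exact hc.mono fun y hy => fun h => hy (hz y h)
  · exact (Real.rpow_pos_of_pos (abs_pos.2 hx) s).ne'

section Finsler

variable {N : ℕ} {F : EuclideanSpace ℝ (Fin N) → ℝ} {Ω : Set (EuclideanSpace ℝ (Fin N))}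

lemma finslerLambda_nonneg (hF0 : ∀ ξ, 0 ≤ F ξ) (p : ℝ) : 0 ≤ finslerLambda N F p Ω := by
  refine Real.sInf_nonneg ?_
  rintro _ ⟨u, -, rfl⟩
  exact div_nonneg (integral_nonneg fun x => Real.rpow_nonneg (hF0 _) _)
    (integral_nonneg fun x => by positivity)

lemma finslerLambda_mul_le (hF0 : ∀ ξ, 0 ≤ F ξ) {p : ℝ} (hp : 0 < p)
    {u : EuclideanSpace ℝ (Fin N) → ℝ} (hu : ContDiff ℝ (⊤ : ℕ∞) u)
    (hc : HasCompactSupport u) (hsub : tsupport u ⊆ Ω) (h0 : u ≠ 0) :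
    finslerLambda N F p Ω * ∫ x in Ω, |u x| ^ p ≤ ∫ x in Ω, F (gradient u x) ^ p := by
  rw [← le_div_iff₀ (setIntegral_rpow_abs_pos hp hu.continuous hc hsub h0)]
  refine csInf_le ⟨0, ?_⟩ ⟨u, ⟨hu, hc, hsub, h0⟩, rfl⟩
  rintro _ ⟨u, -, rfl⟩
  exact div_nonneg (integral_nonneg fun x => Real.rpow_nonneg (hF0 _) _)
    (integral_nonneg fun x => by positivity)

lemma finslerLambda_mul_le_regularized {b p s e : ℝ} (hb : 0 ≤ b) (hF0 : ∀ ξ, 0 ≤ F ξ)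
    (hFc : Continuous F)
    (hhom : ∀ (t : ℝ) (ξ : EuclideanSpace ℝ (Fin N)), F (t • ξ) = |t| * F ξ)
    (hupp : ∀ ξ, F ξ ≤ b * ‖ξ‖) (hΩbd : Bornology.IsBounded Ω) (hp : 0 < p) (hps : p < s)
    (he : 0 < e) {u : EuclideanSpace ℝ (Fin N) → ℝ} (hu : ContDiff ℝ (⊤ : ℕ∞) u)
    (hc : HasCompactSupport u) (hsub : tsupport u ⊆ Ω) (h0 : u ≠ 0) :
    finslerLambda N F p Ω * ∫ x in Ω, |u x| ^ s ≤
      (s / p) ^ p * ((∫ x in Ω, F (gradient u x) ^ s) ^ (p / s) *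
        (∫ x in Ω, √(u x ^ 2 + e) ^ s) ^ (1 - p / s)) := by
  have hs : 0 < s := hp.trans hps
  have hq : 1 ≤ s / p := ((one_lt_div hp).2 hps).le
  have : IsFiniteMeasure (volume.restrict Ω) :=
    isFiniteMeasure_restrict.2 hΩbd.measure_lt_top.ne
  obtain ⟨C, hC⟩ := hc.exists_norm_gradient_le hu
  obtain ⟨D, hD⟩ := hc.exists_bound_of_continuous hu.continuous
  have hφ := contDiff_regPow (s / p) he
  set v := regPow (s / p) e ∘ u with hv
  have hzero : regPow (s / p) e 0 = 0 := by simp [regPow]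
  have hvle : ∀ x, |u x| ^ s ≤ |v x| ^ p := fun x => by
    calc |u x| ^ s = (|u x| ^ (s / p)) ^ p := by
          rw [← Real.rpow_mul (abs_nonneg _), div_mul_cancel₀ _ hp.ne']
      _ ≤ _ := Real.rpow_le_rpow (by positivity) (rpow_abs_le_abs_regPow hq he _) hp.le
  have hvc : HasCompactSupport v := hc.comp_left hzero
  have hvsub : tsupport v ⊆ Ω :=
    (closure_mono (Function.support_comp_subset hzero u)).trans hsub
  have hv0 : v ≠ 0 := by
    obtain ⟨x, hx⟩ := Function.ne_iff.1 h0
    intro h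
    have h1 := hvle x
    rw [h, Pi.zero_apply, abs_zero, Real.zero_rpow hp.ne'] at h1
    exact h1.not_gt (Real.rpow_pos_of_pos (abs_pos.2 hx) s)
  have hvsm : ContDiff ℝ (⊤ : ℕ∞) v := hφ.comp hu
  have hint : ∀ {w : EuclideanSpace ℝ (Fin N) → ℝ} {r : ℝ}, 0 < r → Continuous w →
      HasCompactSupport w → IntegrableOn (fun x => |w x| ^ r) Ω := fun hr hw hwc =>
    ((hw.abs.rpow_const fun _ => Or.inr hr.le).integrable_of_hasCompactSupport
      (hwc.comp_left (g := fun t => |t| ^ _) (by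
        simp only [abs_zero]; exact Real.zero_rpow hr.ne'))).integrableOn
  have hmeas : Measurable fun x => F (gradient u x) :=
    (hFc.comp (continuous_gradient hu)).measurable
  have hFle : ∀ x, F (gradient u x) ≤ b * C := fun x =>
    (hupp _).trans (mul_le_mul_of_nonneg_left (hC x) hb)
  have hgle : ∀ x, √(u x ^ 2 + e) ≤ √(D ^ 2 + e) := fun x => by
    have := sq_le_sq' (neg_le_of_abs_le (hD x)) (le_of_abs_le (hD x))
    gcongr
  have hgrad : ∀ x, F (gradient v x) ^ p ≤
      (s / p) ^ p * (F (gradient u x) ^ p * √(u x ^ 2 + e) ^ (s - p)) := fun x => by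
    have h1 : √(u x ^ 2 + e) ^ (s - p) = ((u x ^ 2 + e) ^ ((s / p - 1) / 2)) ^ p := by
      rw [Real.sqrt_eq_rpow, ← Real.rpow_mul (by positivity), ← Real.rpow_mul (by positivity)]
      congr 1; field_simp
    rw [hv, gradient_comp_real (hφ.differentiable (by simp) _) (hu.differentiable (by simp) _),
      hhom, h1, mul_comm (F _ ^ p), ← mul_assoc, ← Real.mul_rpow (by positivity) (by positivity),
      ← Real.mul_rpow (by positivity) (hF0 _)]
    exact Real.rpow_le_rpow (mul_nonneg (abs_nonneg _) (hF0 _))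
      (mul_le_mul_of_nonneg_right (abs_deriv_regPow_le hq he _) (hF0 _)) hp.le
  have hgmeas : Measurable fun x => √(u x ^ 2 + e) :=
    ((hu.continuous.measurable.pow_const 2).add_const e).sqrt
  have hgint : Integrable (fun x => F (gradient u x) ^ p * √(u x ^ 2 + e) ^ (s - p))
      (volume.restrict Ω) := by
    refine Integrable.of_bound
      ((hmeas.pow_const p).mul (hgmeas.pow_const (s - p))).aestronglyMeasurable
      ((b * C) ^ p * √(D ^ 2 + e) ^ (s - p))
      (.of_forall fun x => ?_)
    have h1 := Real.rpow_nonneg (hF0 (gradient u x)) p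
    rw [Real.norm_of_nonneg (by positivity)]
    exact mul_le_mul (Real.rpow_le_rpow (hF0 _) (hFle x) hp.le)
      (Real.rpow_le_rpow (by positivity) (hgle x) (by linarith)) (by positivity)
      (Real.rpow_nonneg ((hF0 _).trans (hFle x)) _)
  calc finslerLambda N F p Ω * ∫ x in Ω, |u x| ^ s
      ≤ finslerLambda N F p Ω * ∫ x in Ω, |v x| ^ p :=
        mul_le_mul_of_nonneg_left (integral_mono (hint hs hu.continuous hc)
          (hint hp hvsm.continuous hvc) hvle) (finslerLambda_nonneg hF0 p)
    _ ≤ ∫ x in Ω, F (gradient v x) ^ p := finslerLambda_mul_le hF0 hp hvsm hvc hvsub hv0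
    _ ≤ ∫ x in Ω, (s / p) ^ p * (F (gradient u x) ^ p * √(u x ^ 2 + e) ^ (s - p)) :=
        integral_mono_of_nonneg (.of_forall fun x => Real.rpow_nonneg (hF0 _) _)
          (hgint.const_mul _) (.of_forall hgrad)
    _ = (s / p) ^ p * ∫ x in Ω, F (gradient u x) ^ p * √(u x ^ 2 + e) ^ (s - p) :=
        integral_const_mul _ _
    _ ≤ _ := mul_le_mul_of_nonneg_left (integral_rpow_mul_rpow_le hp hps hmeas hgmeas
        (fun _ => hF0 _) (fun _ => Real.sqrt_nonneg _) hFle hgle) (by positivity)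

lemma finslerLambda_le_rpow_rayleigh {b p s : ℝ} (hb : 0 ≤ b) (hF0 : ∀ ξ, 0 ≤ F ξ)
    (hFc : Continuous F)
    (hhom : ∀ (t : ℝ) (ξ : EuclideanSpace ℝ (Fin N)), F (t • ξ) = |t| * F ξ)
    (hupp : ∀ ξ, F ξ ≤ b * ‖ξ‖) (hΩbd : Bornology.IsBounded Ω) (hp : 0 < p) (hps : p < s)
    {u : EuclideanSpace ℝ (Fin N) → ℝ} (hu : ContDiff ℝ (⊤ : ℕ∞) u)
    (hc : HasCompactSupport u) (hsub : tsupport u ⊆ Ω) (h0 : u ≠ 0) :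
    finslerLambda N F p Ω ≤
      (s / p) ^ p * ((∫ x in Ω, F (gradient u x) ^ s) / ∫ x in Ω, |u x| ^ s) ^ (p / s) := by
  have hs : 0 < s := hp.trans hps
  have : IsFiniteMeasure (volume.restrict Ω) :=
    isFiniteMeasure_restrict.2 hΩbd.measure_lt_top.ne
  obtain ⟨D, hD⟩ := hc.exists_bound_of_continuous hu.continuous
  have hA := setIntegral_rpow_abs_pos (μ := volume) hs hu.continuous hc hsub h0
  have hB : 0 ≤ ∫ x in Ω, F (gradient u x) ^ s :=
    integral_nonneg fun x => Real.rpow_nonneg (hF0 _) _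
  have hlim := (((tendsto_integral_sqrt_sq_add_rpow (μ := volume.restrict Ω) hs
    hu.continuous.measurable hD).rpow_const (p := 1 - p / s) (Or.inl hA.ne')).const_mul
    ((∫ x in Ω, F (gradient u x) ^ s) ^ (p / s))).const_mul ((s / p) ^ p)
  have key := ge_of_tendsto hlim (Filter.eventually_of_mem self_mem_nhdsWithin fun e he =>
    finslerLambda_mul_le_regularized hb hF0 hFc hhom hupp hΩbd hp hps he hu hc hsub h0)
  rw [← le_div_iff₀ hA] at key
  refine key.trans_eq ?_
  rw [Real.rpow_sub hA, Real.rpow_one, Real.div_rpow hB hA.le]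
  field_simp

end Finsler

/-- Monotonicity in `p`: if `1 < p < s` then
`p λ_p(Ω)^{1/p} ≤ s λ_s(Ω)^{1/s}`. -/
theorem stmt_11 (N : ℕ) (hN : 2 ≤ N)
    (F : EuclideanSpace ℝ (Fin N) → ℝ)
    (a b : ℝ) (ha : 0 < a) (hab : a ≤ b)
    (hF0 : ∀ ξ, 0 ≤ F ξ)
    (hconv : ConvexOn ℝ Set.univ F)
    (hhom : ∀ (t : ℝ) (ξ : EuclideanSpace ℝ (Fin N)), F (t • ξ) = |t| * F ξ)
    (hlow : ∀ ξ, a * ‖ξ‖ ≤ F ξ)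
    (hupp : ∀ ξ, F ξ ≤ b * ‖ξ‖)
    (Ω : Set (EuclideanSpace ℝ (Fin N)))
    (hΩo : IsOpen Ω) (hΩne : Ω.Nonempty) (hΩbd : Bornology.IsBounded Ω)
    (p s : ℝ) (hp : 1 < p) (hps : p < s) :
    p * (finslerLambda N F p Ω) ^ (1 / p) ≤ s * (finslerLambda N F s Ω) ^ (1 / s) := by
  have hp0 : 0 < p := by linarith
  have hs0 : 0 < s := by linarith
  have hFc : Continuous F := continuousOn_univ.1 (hconv.continuousOn isOpen_univ)
  have hL := finslerLambda_nonneg (Ω := Ω) hF0 p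
  rcases ({u : EuclideanSpace ℝ (Fin N) → ℝ | ContDiff ℝ (⊤ : ℕ∞) u ∧ HasCompactSupport u ∧
    tsupport u ⊆ Ω ∧ u ≠ 0}).eq_empty_or_nonempty with hem | hne
  · simp only [finslerLambda, hem, Set.image_empty, Real.sInf_empty]
    rw [Real.zero_rpow (one_div_pos.2 hp0).ne', Real.zero_rpow (one_div_pos.2 hs0).ne']
    simp
  have hle : (p / s * finslerLambda N F p Ω ^ (1 / p)) ^ s ≤ finslerLambda N F s Ω := by
    refine le_csInf (hne.image _) ?_
    rintro _ ⟨u, ⟨hu, hc, hsub, h0⟩, rfl⟩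
    have h1 := finslerLambda_le_rpow_rayleigh (ha.le.trans hab) hF0 hFc hhom hupp hΩbd hp0 hps
      hu hc hsub h0
    dsimp only
    set R := (∫ x in Ω, F (gradient u x) ^ s) / ∫ x in Ω, |u x| ^ s with hR
    have hR0 : 0 ≤ R := div_nonneg (integral_nonneg fun x => Real.rpow_nonneg (hF0 _) _)
      (integral_nonneg fun x => by positivity)
    have h2 : finslerLambda N F p Ω ^ (1 / p) ≤ s / p * R ^ (1 / s) := by
      refine (Real.rpow_le_rpow hL h1 (by positivity)).trans_eq ?_
      rw [Real.mul_rpow (by positivity) (by positivity), ← Real.rpow_mul (by positivity),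
        ← Real.rpow_mul hR0, mul_one_div_cancel hp0.ne', Real.rpow_one]
      congr 2; field_simp
    calc (p / s * finslerLambda N F p Ω ^ (1 / p)) ^ s
        ≤ (p / s * (s / p * R ^ (1 / s))) ^ s := by gcongr
      _ = (R ^ (1 / s)) ^ s := by congr 1; field_simp
      _ = R := by rw [← Real.rpow_mul hR0, one_div_mul_cancel hs0.ne', Real.rpow_one]
  have h3 := Real.rpow_le_rpow (by positivity) hle (one_div_pos.2 hs0).le
  rw [← Real.rpow_mul (by positivity), mul_one_div_cancel hs0.ne', Real.rpow_one] at h3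
  calc p * finslerLambda N F p Ω ^ (1 / p)
      = s * (p / s * finslerLambda N F p Ω ^ (1 / p)) := by field_simp
    _ ≤ _ := mul_le_mul_of_nonneg_left h3 hs0.le
end

section
/- Let Ω be a nonempty bounded open subset of ℝ^N. Let φ_n (n ∈ ℕ) and φ̃ be continuously differentiable maps from ℝ^N to ℝ^N, each injective on the closure of Ω with det Dφ_n(x) ≠ 0 and det Dφ̃(x) ≠ 0 for all x in the closure of Ω, and suppose that φ_n → φ̃ and Dφ_n → Dφ̃ uniformly on the closure of Ω. Then for every compact set K contained in φ̃(Ω) there exists n_0 ∈ ℕ such that K ⊆ φ_n(Ω) for all n ≥ n_0. -/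
open Filter Topology Metric in
/-- Stability of local surjectivity: if `f i → g` at `a` and `D(f i) → Dg` uniformly on an open set
`U` containing `a`, where `Dg` is continuous and surjective at `a`, then a fixed neighbourhood of
`g a` is eventually contained in `f i '' U`. -/
theorem exists_nhds_eventually_subset_image {E F ι : Type*}
    [NormedAddCommGroup E] [NormedSpace ℝ E] [CompleteSpace E]
    [NormedAddCommGroup F] [NormedSpace ℝ F] [CompleteSpace F]
    {l : Filter ι} {f : ι → E → F} {g : E → F} {U : Set E} {a : E}
    (hU : IsOpen U) (ha : a ∈ U)
    (hf : ∀ i, ∀ x ∈ U, DifferentiableAt ℝ (f i) x)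
    (hg : ContinuousAt (fderiv ℝ g) a)
    (hsurj : (fderiv ℝ g a).range = ⊤)
    (hlim : Tendsto (fun i => f i a) l (𝓝 (g a)))
    (hlim' : TendstoUniformlyOn (fun i x => fderiv ℝ (f i) x) (fderiv ℝ g) l U) :
    ∃ t ∈ 𝓝 (g a), ∀ᶠ i in l, t ⊆ f i '' U := by
  obtain ⟨S, hS⟩ := (fderiv ℝ g a).exists_nonlinearRightInverse_of_surjective hsurj
  set c : NNReal := S.nnnorm⁻¹ / 2 with hc
  have hc0 : 0 < c := by positivity
  have hc0' : (0 : ℝ) < c := by exact_mod_cast hc0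
  have hSc : (S.nnnorm : ℝ)⁻¹ - c = c := by rw [hc]; push_cast; ring
  obtain ⟨r, hr, hball⟩ : ∃ r > 0, closedBall a r ⊆
      U ∩ {x | dist (fderiv ℝ g x) (fderiv ℝ g a) < c / 2} :=
    nhds_basis_closedBall.mem_iff.1 <| inter_mem (hU.mem_nhds ha) <|
      hg.eventually (ball_mem_nhds _ (half_pos hc0'))
  refine ⟨ball (g a) (c * r / 2), ball_mem_nhds _ (by positivity), ?_⟩
  filter_upwards [tendstoUniformlyOn_iff.1 hlim' (c / 2) (half_pos hc0'),
    hlim.eventually (ball_mem_nhds (g a) (show 0 < (c : ℝ) * r / 2 by positivity))]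
    with i hi hia
  have happrox : ApproximatesLinearOn (f i) (fderiv ℝ g a) (closedBall a r) c := by
    intro x hx y hy
    refine (convex_closedBall a r).norm_image_sub_le_of_norm_fderiv_le' (𝕜 := ℝ)
      (fun z hz => hf i z (hball hz).1) (fun z hz => ?_) hy hx
    rw [← dist_eq_norm]
    have h₁ : dist (fderiv ℝ g z) (fderiv ℝ (f i) z) < c / 2 := hi z (hball hz).1
    have h₂ : dist (fderiv ℝ g z) (fderiv ℝ g a) < c / 2 := (hball hz).2
    linarith [dist_triangle_left (fderiv ℝ (f i) z) (fderiv ℝ g a) (fderiv ℝ g z)]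
  have hsub := happrox.surjOn_closedBall_of_nonlinearRightInverse S hr.le subset_rfl
  rw [hSc] at hsub
  intro y hy
  refine Set.image_mono (fun x hx => (hball hx).1) (hsub ?_)
  rw [mem_ball] at hy
  rw [mem_closedBall]
  linarith [dist_triangle_right y (f i a) (g a)]


/-- If `φₙ → φ̃` together with the Jacobians, uniformly on the closure of a
nonempty bounded open set `Ω`, with all maps `C¹`, injective on the closure and with
non-vanishing Jacobian determinants there, then every compact subset of `φ̃(Ω)` is contained
in `φₙ(Ω)` for all sufficiently large `n`. -/
theorem stmt_18 (N : ℕ) (hN : 2 ≤ N)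
    (Ω : Set (EuclideanSpace ℝ (Fin N)))
    (hΩo : IsOpen Ω) (hΩne : Ω.Nonempty) (hΩbd : Bornology.IsBounded Ω)
    (φ : ℕ → EuclideanSpace ℝ (Fin N) → EuclideanSpace ℝ (Fin N))
    (ψ : EuclideanSpace ℝ (Fin N) → EuclideanSpace ℝ (Fin N))
    (hφC1 : ∀ n, ContDiff ℝ 1 (φ n)) (hψC1 : ContDiff ℝ 1 ψ)
    (hφinj : ∀ n, Set.InjOn (φ n) (closure Ω)) (hψinj : Set.InjOn ψ (closure Ω))
    (hφdet : ∀ n, ∀ x ∈ closure Ω,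
      LinearMap.det ((fderiv ℝ (φ n) x :
        EuclideanSpace ℝ (Fin N) →L[ℝ] EuclideanSpace ℝ (Fin N)) :
        EuclideanSpace ℝ (Fin N) →ₗ[ℝ] EuclideanSpace ℝ (Fin N)) ≠ 0)
    (hψdet : ∀ x ∈ closure Ω,
      LinearMap.det ((fderiv ℝ ψ x :
        EuclideanSpace ℝ (Fin N) →L[ℝ] EuclideanSpace ℝ (Fin N)) :
        EuclideanSpace ℝ (Fin N) →ₗ[ℝ] EuclideanSpace ℝ (Fin N)) ≠ 0)
    (hconv : TendstoUniformlyOn (fun n x => φ n x) ψ Filter.atTop (closure Ω))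
    (hconvD : TendstoUniformlyOn (fun n x => fderiv ℝ (φ n) x) (fun x => fderiv ℝ ψ x)
      Filter.atTop (closure Ω)) :
    ∀ K : Set (EuclideanSpace ℝ (Fin N)), IsCompact K → K ⊆ ψ '' Ω →
      ∃ n₀ : ℕ, ∀ n ≥ n₀, K ⊆ φ n '' Ω := by
  intro K hK hKsub
  suffices h : ∀ᶠ n in Filter.atTop, K ⊆ φ n '' Ω from Filter.eventually_atTop.1 h
  refine hK.induction_on (p := fun s => ∀ᶠ n in Filter.atTop, s ⊆ φ n '' Ω) (by simp)
    (fun s t hst ht => ht.mono fun n hn => hst.trans hn)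
    (fun s t hs ht => (hs.and ht).mono fun n hn => Set.union_subset hn.1 hn.2) ?_
  intro y hy
  obtain ⟨x, hx, rfl⟩ := hKsub hy
  have hsurj : (fderiv ℝ ψ x).range = ⊤ :=
    LinearMap.range_eq_top.2 <|
      ((fderiv ℝ ψ x).toContinuousLinearEquivOfDetNeZero
        (hψdet x (subset_closure hx))).surjective
  obtain ⟨t, ht, hsub⟩ := exists_nhds_eventually_subset_image hΩo hx
    (fun n z _ => (hφC1 n).differentiable one_ne_zero z)
    (hψC1.continuous_fderiv one_ne_zero).continuousAt hsurj
    (hconv.tendsto_at (subset_closure hx)) (hconvD.mono subset_closure)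
  exact ⟨t, mem_nhdsWithin_of_mem_nhds ht, hsub⟩
end
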